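/- arXiv:2202.08932 — 2 statements merged into one kernel-verified Lean document; each statement's English description precedes it below -/
import Mathlib

section
/- A ternary cubic form f over ℂ has Waring rank 3 if and only if either f = a²·b for some linearly independent linear forms a, b, or f = a³ + b³ + c³ for some linearly independent linear forms a, b, c. -/
open MvPolynomial

/-- Ternary forms: polynomials in three variables over `ℂ`. -/
abbrev Ternary : Type := MvPolynomial (Fin 3) ℂ

/-- A linear form is a homogeneous polynomial of degree 1. -/
def IsLinearForm (a : Ternary) : Prop := MvPolynomial.IsHomogeneous a 1

/-- The Waring rank of a form `f` (with respect to degree `d`): the least `r`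
such that `f` is a sum of `r` `d`-th powers of linear forms. -/
noncomputable def waringRank (d : ℕ) (f : Ternary) : ℕ :=
  sInf {r : ℕ | ∃ l : Fin r → Ternary, (∀ i, IsLinearForm (l i)) ∧ f = ∑ i, (l i) ^ d}

/-- The Hessian determinant of a ternary form: the determinant of the matrix of
second partial derivatives. -/
noncomputable def hess (f : Ternary) : Ternary :=
  Matrix.det (Matrix.of fun i j : Fin 3 =>
    MvPolynomial.pderiv i (MvPolynomial.pderiv j f))

/-- `[abc]`: the determinant of the 3×3 matrix whose rows are the coefficients of
the linear forms `a`, `b`, `c`. -/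
noncomputable def bracket (a b c : Ternary) : ℂ :=
  Matrix.det (Matrix.of
    ![![MvPolynomial.coeff (Finsupp.single 0 1) a, MvPolynomial.coeff (Finsupp.single 1 1) a,
        MvPolynomial.coeff (Finsupp.single 2 1) a],
      ![MvPolynomial.coeff (Finsupp.single 0 1) b, MvPolynomial.coeff (Finsupp.single 1 1) b,
        MvPolynomial.coeff (Finsupp.single 2 1) b],
      ![MvPolynomial.coeff (Finsupp.single 0 1) c, MvPolynomial.coeff (Finsupp.single 1 1) c,
        MvPolynomial.coeff (Finsupp.single 2 1) c]])

namespace Ternary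

/-- A ternary form that is a sum of at most two cubes of linear forms. -/
def IsSumTwoCubes (f : Ternary) : Prop :=
  ∃ a b : Ternary, IsLinearForm a ∧ IsLinearForm b ∧ f = a ^ 3 + b ^ 3

end Ternary

open Ternary

lemma IsLinearForm.zero : IsLinearForm 0 := isHomogeneous_zero _ _ _

lemma IsLinearForm.add {a b : Ternary} (ha : IsLinearForm a) (hb : IsLinearForm b) :
    IsLinearForm (a + b) :=
  IsHomogeneous.add ha hb

lemma IsLinearForm.C_mul {a : Ternary} (ha : IsLinearForm a) (k : ℂ) :
    IsLinearForm (C k * a) :=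
  IsHomogeneous.C_mul ha k

/-- A linear form is the combination of the variables with its own coefficients. -/
lemma IsLinearForm.exists_eq_sum {a : Ternary} (ha : IsLinearForm a) :
    ∃ v : Fin 3 → ℂ, a = ∑ i, v i • X i := by
  have h : a ∈ homogeneousSubmodule (Fin 3) ℂ 1 := ha
  rw [homogeneousSubmodule_one_eq_span_X, Submodule.mem_span_range_iff_exists_fun] at h
  obtain ⟨v, hv⟩ := h
  exact ⟨v, hv.symm⟩

lemma IsLinearForm.eval_add {a : Ternary} (ha : IsLinearForm a) (p q : Fin 3 → ℂ) (x y : ℂ) :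
    eval (x • p + y • q) a = x * eval p a + y * eval q a := by
  obtain ⟨v, rfl⟩ := ha.exists_eq_sum
  simp [Fin.sum_univ_three, smul_eval]
  ring

/-- Linearly independent linear forms take prescribed values at some point. -/
lemma exists_eval_eq {ι : Type*} {v : ι → Ternary} (hv : LinearIndependent ℂ v)
    (hl : ∀ i, IsLinearForm (v i)) (c : ι → ℂ) :
    ∃ p : Fin 3 → ℂ, ∀ i, eval p (v i) = c i := by
  obtain ⟨g, hg⟩ := LinearMap.exists_extend ((Finsupp.linearCombination ℂ c).comp
    (hv.repr : Submodule.span ℂ (Set.range v) →ₗ[ℂ] ι →₀ ℂ))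
  refine ⟨fun j => g (X j), fun i => ?_⟩
  have h1 : g (v i) = c i := by
    have h := LinearMap.congr_fun hg ⟨v i, Submodule.subset_span ⟨i, rfl⟩⟩
    simpa [hv.repr_eq_single i ⟨v i, Submodule.subset_span ⟨i, rfl⟩⟩ rfl] using h
  obtain ⟨w, hw⟩ := (hl i).exists_eq_sum
  rw [← h1, hw]
  simp [smul_eval]

lemma waringRank_three_eq_three_iff (f : Ternary) :
    waringRank 3 f = 3 ↔
      (∃ a b c : Ternary, IsLinearForm a ∧ IsLinearForm b ∧ IsLinearForm c ∧
        f = a ^ 3 + b ^ 3 + c ^ 3) ∧ ¬ IsSumTwoCubes f := by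
  unfold waringRank
  constructor
  · intro h
    refine ⟨?_, ?_⟩
    · have hmem := Nat.sInf_mem (Nat.nonempty_of_sInf_eq_succ h)
      rw [h] at hmem
      obtain ⟨l, hl, rfl⟩ := hmem
      exact ⟨l 0, l 1, l 2, hl 0, hl 1, hl 2, by rw [Fin.sum_univ_three]⟩
    · rintro ⟨a, b, ha, hb, hf⟩
      have hle := Nat.sInf_le
        (show 2 ∈ {r : ℕ | ∃ l : Fin r → Ternary, (∀ i, IsLinearForm (l i)) ∧
          f = ∑ i, (l i) ^ 3} from
          ⟨![a, b], by simp [Fin.forall_fin_two, ha, hb], by simp [hf]⟩)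
      omega
  · rintro ⟨⟨a, b, c, ha, hb, hc, hf⟩, hn⟩
    have hmem : 3 ∈ {r : ℕ | ∃ l : Fin r → Ternary, (∀ i, IsLinearForm (l i)) ∧
        f = ∑ i, (l i) ^ 3} :=
      ⟨![a, b, c], by simp [Fin.forall_fin_succ, ha, hb, hc], by simp [hf, Fin.sum_univ_three]⟩
    have hle := Nat.sInf_le hmem
    obtain ⟨l, hl, hs⟩ := Nat.sInf_mem ⟨3, hmem⟩
    by_contra hne
    generalize sInf {r : ℕ | ∃ l : Fin r → Ternary, (∀ i, IsLinearForm (l i)) ∧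
      f = ∑ i, (l i) ^ 3} = r at *
    have hr : r < 3 := by omega
    interval_cases r
    · exact hn ⟨0, 0, .zero, .zero, by simp [hs]⟩
    · exact hn ⟨l 0, 0, hl 0, .zero, by simp [hs]⟩
    · exact hn ⟨l 0, l 1, hl 0, hl 1, by simp [hs]⟩

/-- A scalar multiple of the cube of a linear form is the cube of a linear form. -/
lemma IsLinearForm.exists_cube_eq {a : Ternary} (ha : IsLinearForm a) (k : ℂ) :
    ∃ b, IsLinearForm b ∧ b ^ 3 = C k * a ^ 3 := by
  obtain ⟨z, hz⟩ := IsAlgClosed.exists_pow_nat_eq k (n := 3) (by norm_num)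
  exact ⟨C z * a, ha.C_mul z, by rw [mul_pow, ← map_pow, hz]⟩

lemma isSumTwoCubes_of_eq {f a b : Ternary} (ha : IsLinearForm a) (hb : IsLinearForm b)
    (k m : ℂ) (hf : f = C k * a ^ 3 + C m * b ^ 3) : IsSumTwoCubes f := by
  obtain ⟨a', ha', h1⟩ := ha.exists_cube_eq k
  obtain ⟨b', hb', h2⟩ := hb.exists_cube_eq m
  exact ⟨a', b', ha', hb', by rw [h1, h2, hf]⟩

lemma isSumTwoCubes_or_linearIndependent {a b : Ternary} (ha : IsLinearForm a) :
    IsSumTwoCubes (a ^ 2 * b) ∨ LinearIndependent ℂ ![a, b] := by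
  by_cases h0 : a = 0
  · exact .inl ⟨0, 0, .zero, .zero, by simp [h0]⟩
  rw [LinearIndependent.pair_iff' h0]
  by_cases h : ∀ k : ℂ, k • a ≠ b
  · exact .inr h
  push Not at h
  obtain ⟨k, rfl⟩ := h
  refine .inl (isSumTwoCubes_of_eq ha .zero k 0 ?_)
  rw [smul_eq_C_mul]
  simp
  ring

/-- A binary cubic whose coefficients satisfy the recurrence with distinct roots `r₁`, `r₂` is a
combination of two cubes. -/
lemma binary_cubic_eq_of_ne (x y : Ternary) {a₀ a₁ a₂ a₃ r₁ r₂ : ℂ} (hr : r₁ ≠ r₂)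
    (h₂ : a₂ = (r₁ + r₂) * a₁ - r₁ * r₂ * a₀) (h₃ : a₃ = (r₁ + r₂) * a₂ - r₁ * r₂ * a₁) :
    ∃ k m : ℂ, C a₀ * x ^ 3 + C (3 * a₁) * x ^ 2 * y + C (3 * a₂) * x * y ^ 2 + C a₃ * y ^ 3 =
      C k * (x + C r₁ * y) ^ 3 + C m * (x + C r₂ * y) ^ 3 := by
  have hd : r₁ - r₂ ≠ 0 := sub_ne_zero.mpr hr
  obtain ⟨k, hk⟩ : ∃ k, k * (r₁ - r₂) = a₁ - a₀ * r₂ := ⟨_, div_mul_cancel₀ _ hd⟩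
  have e1 : a₁ = k * r₁ + (a₀ - k) * r₂ := by linear_combination -hk
  have e2 : a₂ = k * r₁ ^ 2 + (a₀ - k) * r₂ ^ 2 := by rw [h₂, e1]; ring
  have e3 : a₃ = k * r₁ ^ 3 + (a₀ - k) * r₂ ^ 3 := by rw [h₃, e2, e1]; ring
  refine ⟨k, a₀ - k, ?_⟩
  rw [e3, e2, e1]
  simp only [map_mul, map_add, map_sub, map_pow, map_ofNat]
  ring

/-- A binary cubic whose coefficients satisfy the recurrence with double root `r` has a square
linear factor. -/
lemma binary_cubic_eq_of_double_root (x y : Ternary) {a₀ a₁ a₂ a₃ r : ℂ}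
    (h₂ : a₂ = 2 * r * a₁ - r ^ 2 * a₀) (h₃ : a₃ = 2 * r * a₂ - r ^ 2 * a₁) :
    C a₀ * x ^ 3 + C (3 * a₁) * x ^ 2 * y + C (3 * a₂) * x * y ^ 2 + C a₃ * y ^ 3 =
      (x + C r * y) ^ 2 * (C a₀ * x + C (3 * a₁ - 2 * a₀ * r) * y) := by
  rw [h₃, h₂]
  simp only [map_mul, map_sub, map_pow, map_ofNat]
  ring

lemma isSumTwoCubes_or_eq_sq_mul {x y : Ternary} (hx : IsLinearForm x) (hy : IsLinearForm y)
    (s t : ℂ) :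
    IsSumTwoCubes (x ^ 3 + y ^ 3 + (C s * x + C t * y) ^ 3) ∨
      ∃ a b, IsLinearForm a ∧ IsLinearForm b ∧
        x ^ 3 + y ^ 3 + (C s * x + C t * y) ^ 3 = a ^ 2 * b := by
  by_cases hs : s = 0
  · refine .inl (isSumTwoCubes_of_eq hx hy 1 (1 + t ^ 3) ?_)
    simp [hs]
    ring
  by_cases ht : t = 0
  · refine .inl (isSumTwoCubes_of_eq hx hy (1 + s ^ 3) 1 ?_)
    simp [ht]
    ring
  have key : x ^ 3 + y ^ 3 + (C s * x + C t * y) ^ 3 = C (1 + s ^ 3) * x ^ 3 +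
      C (3 * (s ^ 2 * t)) * x ^ 2 * y + C (3 * (s * t ^ 2)) * x * y ^ 2 +
      C (1 + t ^ 3) * y ^ 3 := by
    simp only [map_mul, map_add, map_pow, map_ofNat, map_one]
    ring
  obtain ⟨P, hP⟩ : ∃ P, P * (s * t ^ 2) = 1 + s ^ 3 + t ^ 3 :=
    ⟨_, div_mul_cancel₀ _ (by positivity)⟩
  obtain ⟨Q, hQ⟩ : ∃ Q, Q * t = s := ⟨_, div_mul_cancel₀ _ ht⟩
  have h₂ : s * t ^ 2 = P * (s ^ 2 * t) - Q * (1 + s ^ 3) := by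
    apply mul_right_cancel₀ ht
    linear_combination (-s) * hP + (1 + s ^ 3) * hQ
  have h₃ : 1 + t ^ 3 = P * (s * t ^ 2) - Q * (s ^ 2 * t) := by
    linear_combination -hP + s ^ 2 * hQ
  obtain ⟨δ, hδ⟩ := IsAlgClosed.exists_pow_nat_eq (P ^ 2 - 4 * Q) (n := 2) (by norm_num)
  have hprod : (P + δ) / 2 * ((P - δ) / 2) = Q := by linear_combination -hδ / 4
  have hsum : (P + δ) / 2 + (P - δ) / 2 = P := by ring
  rw [key]
  by_cases hδ0 : δ = 0
  · refine .inr ⟨_, _, hx.add (hy.C_mul (P / 2)), (hx.C_mul _).add (hy.C_mul _),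
      binary_cubic_eq_of_double_root x y (r := P / 2) ?_ ?_⟩
    · rw [hδ0] at hprod
      linear_combination h₂ + (1 + s ^ 3) * hprod
    · rw [hδ0] at hprod
      linear_combination h₃ + (s ^ 2 * t) * hprod
  · left
    have hne : (P + δ) / 2 ≠ (P - δ) / 2 := fun h => hδ0 (by linear_combination h)
    obtain ⟨k, m, h⟩ := binary_cubic_eq_of_ne x y (a₀ := 1 + s ^ 3)
      (a₁ := s ^ 2 * t) (a₂ := s * t ^ 2) (a₃ := 1 + t ^ 3) hne
      (by rw [hsum, hprod]; exact h₂) (by rw [hsum, hprod]; exact h₃)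
    exact isSumTwoCubes_of_eq (hx.add (hy.C_mul _)) (hx.add (hy.C_mul _)) k m h

/-- Three linearly dependent linear forms: the sum of cubes is a sum of two cubes or a square
times a linear form. -/
lemma isSumTwoCubes_or_eq_sq_mul_of_dependent {a b c : Ternary} (ha : IsLinearForm a)
    (hb : IsLinearForm b) (hc : IsLinearForm c) (h : ¬ LinearIndependent ℂ ![a, b, c]) :
    IsSumTwoCubes (a ^ 3 + b ^ 3 + c ^ 3) ∨
      ∃ u v, IsLinearForm u ∧ IsLinearForm v ∧ a ^ 3 + b ^ 3 + c ^ 3 = u ^ 2 * v := by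
  have aux : ∀ {x y z : Ternary} {s t k : ℂ}, k ≠ 0 → C s * x + C t * y + C k * z = 0 →
      z = C (-s / k) * x + C (-t / k) * y := by
    intro x y z s t k hk h
    have hC : C (σ := Fin 3) k⁻¹ * C k = 1 := by rw [← map_mul, inv_mul_cancel₀ hk, map_one]
    simp only [div_eq_mul_inv, map_mul, map_neg]
    linear_combination C k⁻¹ * h - z * hC
  rw [Fintype.not_linearIndependent_iff] at h
  obtain ⟨g, hg, i, hi⟩ := h
  simp only [Fin.sum_univ_three, smul_eq_C_mul, Matrix.cons_val] at hg
  fin_cases i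
  · rw [show a ^ 3 + b ^ 3 + c ^ 3 = b ^ 3 + c ^ 3 + a ^ 3 by ring,
      aux (x := b) (y := c) (z := a) (s := g 1) (t := g 2) hi (by simp only [Fin.zero_eta]; linear_combination hg)]
    exact isSumTwoCubes_or_eq_sq_mul hb hc _ _
  · rw [show a ^ 3 + b ^ 3 + c ^ 3 = a ^ 3 + c ^ 3 + b ^ 3 by ring,
      aux (x := a) (y := c) (z := b) (s := g 0) (t := g 2) hi (by simp only [Fin.mk_one]; linear_combination hg)]
    exact isSumTwoCubes_or_eq_sq_mul ha hc _ _
  · rw [aux (x := a) (y := b) (z := c) hi hg]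
    exact isSumTwoCubes_or_eq_sq_mul ha hb _ _

/-- Comparison of coefficients of a binary cubic with those of a sum of two cubes. -/
lemma binary_cubic_coeffs {A B D E u₀ u₁ v₀ v₁ : ℂ}
    (h : ∀ x y : ℂ, A * x ^ 3 + 3 * B * (x ^ 2 * y) + 3 * D * (x * y ^ 2) + E * y ^ 3 =
      (x * u₀ + y * v₀) ^ 3 + (x * u₁ + y * v₁) ^ 3) :
    u₀ ^ 3 + u₁ ^ 3 = A ∧ u₀ ^ 2 * v₀ + u₁ ^ 2 * v₁ = B ∧
      u₀ * v₀ ^ 2 + u₁ * v₁ ^ 2 = D ∧ v₀ ^ 3 + v₁ ^ 3 = E := by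
  have h10 := h 1 0
  have h01 := h 0 1
  have h11 := h 1 1
  have h1m := h 1 (-1)
  refine ⟨?_, ?_, ?_, ?_⟩
  · linear_combination -h10
  · linear_combination -h11 / 6 + h1m / 6 + h01 / 3
  · linear_combination -h11 / 6 - h1m / 6 + h10 / 3
  · linear_combination -h01

lemma not_isSumTwoCubes_sq_mul {a b : Ternary} (ha : IsLinearForm a) (hb : IsLinearForm b)
    (hi : LinearIndependent ℂ ![a, b]) : ¬ IsSumTwoCubes (a ^ 2 * b) := by
  rintro ⟨l, m, hl, hm, h⟩
  have hlin : ∀ i, IsLinearForm (![a, b] i) := by simp [Fin.forall_fin_two, ha, hb]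
  obtain ⟨p, hp⟩ := exists_eval_eq hi hlin ![1, 0]
  obtain ⟨q, hq⟩ := exists_eval_eq hi hlin ![0, 1]
  simp only [Fin.forall_fin_two, Matrix.cons_val] at hp hq
  obtain ⟨hA, hB, hD, hE⟩ := binary_cubic_coeffs (A := 0) (B := 1 / 3) (D := 0) (E := 0)
    (u₀ := eval p l) (u₁ := eval p m) (v₀ := eval q l) (v₁ := eval q m) fun x y => by
      have e := congrArg (eval (x • p + y • q)) h
      simp only [map_add, map_mul, map_pow, ha.eval_add, hb.eval_add, hl.eval_add,
        hm.eval_add, hp.1, hp.2, hq.1, hq.2] at e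
      linear_combination e
  generalize eval p l = u₀, eval p m = u₁, eval q l = v₀, eval q m = v₁ at hA hB hD hE
  have hz : u₀ * v₀ ^ 2 = 0 := by
    linear_combination (-3 * u₀ * v₀ ^ 2) * hB + 3 * v₀ ^ 3 * hA - 3 * u₁ ^ 3 * hE
      + 3 * u₁ ^ 2 * v₁ * hD
  rcases mul_eq_zero.mp hz with h0 | h0
  · have h1 : u₁ = 0 := by simpa [h0] using hA
    norm_num [h0, h1] at hB
  · have h0 : v₀ = 0 := by simpa using h0
    have h1 : v₁ = 0 := by simpa [h0] using hE
    norm_num [h0, h1] at hB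

lemma not_isSumTwoCubes_sum_three {a b c : Ternary} (ha : IsLinearForm a) (hb : IsLinearForm b)
    (hc : IsLinearForm c) (hi : LinearIndependent ℂ ![a, b, c]) :
    ¬ IsSumTwoCubes (a ^ 3 + b ^ 3 + c ^ 3) := by
  rintro ⟨l, m, hl, hm, h⟩
  have hlin : ∀ i, IsLinearForm (![a, b, c] i) := by simp [Fin.forall_fin_succ, ha, hb, hc]
  choose p hp using fun j : Fin 3 => exists_eval_eq hi hlin (Pi.single j 1)
  have hcoef : ∀ j k, j ≠ k →
      eval (p j) l ^ 3 + eval (p j) m ^ 3 = 1 ∧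
      eval (p j) l ^ 2 * eval (p k) l + eval (p j) m ^ 2 * eval (p k) m = 0 := by
    intro j k hjk
    obtain ⟨h1, h2, -, -⟩ := binary_cubic_coeffs (A := 1) (B := 0) (D := 0) (E := 1)
      (u₀ := eval (p j) l) (u₁ := eval (p j) m) (v₀ := eval (p k) l) (v₁ := eval (p k) m)
      fun x y => by
        have e := congrArg (eval (x • p j + y • p k)) h
        have hj := hp j
        have hk := hp k
        simp only [Fin.forall_fin_succ, Matrix.cons_val] at hj hk
        simp only [map_add, map_pow, ha.eval_add, hb.eval_add, hc.eval_add, hl.eval_add,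
          hm.eval_add] at e
        refine Eq.trans ?_ e
        clear e h hp
        fin_cases j <;> fin_cases k <;> simp_all [Pi.single_apply] <;> ring
    exact ⟨h1, h2⟩
  obtain ⟨hu, huv⟩ := hcoef 0 1 (by decide)
  obtain ⟨-, huw⟩ := hcoef 0 2 (by decide)
  obtain ⟨hv, hvw⟩ := hcoef 1 2 (by decide)
  obtain ⟨hw, -⟩ := hcoef 2 0 (by decide)
  generalize eval (p 0) l = u₀, eval (p 0) m = u₁, eval (p 1) l = v₀, eval (p 1) m = v₁,
    eval (p 2) l = w₀, eval (p 2) m = w₁ at *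
  have hdet : v₀ * w₁ - v₁ * w₀ = 0 := by
    linear_combination (-(v₀ * w₁ - v₁ * w₀)) * hu + (u₀ * w₁ - u₁ * w₀) * huv
      + (u₁ * v₀ - u₀ * v₁) * huw
  have hw₀ : w₀ = 0 := by
    linear_combination -w₀ * hv + v₀ * hvw - v₁ ^ 2 * hdet
  have hw₁ : w₁ = 0 := by
    linear_combination -w₁ * hv + v₁ * hvw + v₀ ^ 2 * hdet
  simp [hw₀, hw₁] at hw

/-- `a² b` is a sum of three cubes, since `6 a² b = (b + a)³ + (b - a)³ - 2 b³`. -/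
lemma exists_sq_mul_eq_sum_three_cubes {a b : Ternary} (ha : IsLinearForm a)
    (hb : IsLinearForm b) : ∃ u v w : Ternary, IsLinearForm u ∧ IsLinearForm v ∧
      IsLinearForm w ∧ a ^ 2 * b = u ^ 3 + v ^ 3 + w ^ 3 := by
  obtain ⟨u, hu, h1⟩ := (hb.add ha).exists_cube_eq (1 / 6)
  obtain ⟨v, hv, h2⟩ := (hb.add (ha.C_mul (-1))).exists_cube_eq (1 / 6)
  obtain ⟨w, hw, h3⟩ := hb.exists_cube_eq (-2 * (1 / 6))
  refine ⟨u, v, w, hu, hv, hw, ?_⟩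
  have h6 : (6 : Ternary) * C (1 / 6) = 1 := by
    rw [← map_ofNat (C (σ := Fin 3) (R := ℂ)) 6, ← map_mul]
    norm_num
  rw [h1, h2, h3]
  simp only [map_mul, map_neg, map_one, map_ofNat]
  linear_combination (-(a ^ 2 * b)) * h6

/-- Characterization of ternary cubic forms of Waring rank 3. -/
theorem cubic_rank_three_iff (f : Ternary) (hf : MvPolynomial.IsHomogeneous f 3) :
    waringRank 3 f = 3 ↔
      ((∃ a b : Ternary, IsLinearForm a ∧ IsLinearForm b ∧
          LinearIndependent ℂ ![a, b] ∧ f = a ^ 2 * b) ∨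
       (∃ a b c : Ternary, IsLinearForm a ∧ IsLinearForm b ∧ IsLinearForm c ∧
          LinearIndependent ℂ ![a, b, c] ∧ f = a ^ 3 + b ^ 3 + c ^ 3)) := by
  rw [waringRank_three_eq_three_iff]
  constructor
  · rintro ⟨⟨a, b, c, ha, hb, hc, rfl⟩, hn⟩
    by_cases hi : LinearIndependent ℂ ![a, b, c]
    · exact .inr ⟨a, b, c, ha, hb, hc, hi, rfl⟩
    obtain ⟨u, v, hu, hv, h⟩ :=
      (isSumTwoCubes_or_eq_sq_mul_of_dependent ha hb hc hi).resolve_left hn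
    rw [h] at hn ⊢
    exact .inl ⟨u, v, hu, hv, (isSumTwoCubes_or_linearIndependent hu).resolve_left hn, rfl⟩
  · rintro (⟨a, b, ha, hb, hi, rfl⟩ | ⟨a, b, c, ha, hb, hc, hi, rfl⟩)
    · exact ⟨exists_sq_mul_eq_sum_three_cubes ha hb, not_isSumTwoCubes_sq_mul ha hb hi⟩
    · exact ⟨⟨a, b, c, ha, hb, hc, rfl⟩, not_isSumTwoCubes_sum_three ha hb hc hi⟩
end

section
/- For a ternary cubic form f over ℂ the following are equivalent: (i) Hess(f) = a³ for some nonzero linear form a; (ii) f = a·(a·c + b²) for some linearly independent linear forms a, b, c. When these conditions hold, the Waring rank of f equals 5. -/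
open MvPolynomial

/-- The linear form with coefficient vector `v`. -/
noncomputable def lin (v : Fin 3 → ℂ) : Ternary := ∑ i, C (v i) * X i

lemma isLinearForm_lin (v : Fin 3 → ℂ) : IsLinearForm (lin v) :=
  IsHomogeneous.sum _ _ _ fun i _ => isHomogeneous_C_mul_X (v i) i

lemma eval_lin (v u : Fin 3 → ℂ) : eval u (lin v) = v ⬝ᵥ u := by
  simp [lin, dotProduct]

lemma eq_C_of_isHomogeneous_zero {f : Ternary} (hf : f.IsHomogeneous 0) : ∃ r, f = C r :=
  ⟨_, totalDegree_eq_zero_iff_eq_C.1 ((totalDegree_zero_iff_isHomogeneous _).2 hf)⟩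

lemma IsLinearForm.exists_eq_lin {a : Ternary} (ha : IsLinearForm a) : ∃ v, a = lin v := by
  choose v hv using fun i => eq_C_of_isHomogeneous_zero (ha.pderiv (i := i))
  refine ⟨v, ?_⟩
  have h := IsHomogeneous.sum_X_mul_pderiv ha
  simp only [hv, one_smul] at h
  rw [← h, lin]
  exact Finset.sum_congr rfl fun i _ => mul_comm _ _

lemma lin_injective : Function.Injective lin := by
  intro v w h
  ext i
  have := congrArg (eval (Pi.single i 1)) h
  simpa [eval_lin] using this

lemma linearIndependent_lin_iff (L : Matrix (Fin 3) (Fin 3) ℂ) :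
    LinearIndependent ℂ ![lin (L 0), lin (L 1), lin (L 2)] ↔ L.det ≠ 0 := by
  let φ : (Fin 3 → ℂ) →ₗ[ℂ] Ternary :=
    { toFun := lin
      map_add' := fun v w => by simp [lin, add_mul, Finset.sum_add_distrib]
      map_smul' := fun r v => by simp [lin, Finset.smul_sum, smul_eq_C_mul, mul_assoc] }
  have hφ : φ.ker = ⊥ := LinearMap.ker_eq_bot.2 lin_injective
  have h : ![lin (L 0), lin (L 1), lin (L 2)] = φ ∘ L.row := by
    ext1 i
    fin_cases i <;> rfl
  rw [h, φ.linearIndependent_iff hφ, Matrix.linearIndependent_rows_iff_isUnit,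
    Matrix.isUnit_iff_isUnit_det, isUnit_iff_ne_zero]

/-- Substitution of the linear forms given by the rows of `L` for the variables. -/
noncomputable def subst (L : Matrix (Fin 3) (Fin 3) ℂ) : Ternary →ₐ[ℂ] Ternary :=
  aeval fun i => lin (L i)

@[simp] lemma subst_X (L : Matrix (Fin 3) (Fin 3) ℂ) (i : Fin 3) : subst L (X i) = lin (L i) := by
  simp [subst]

@[simp] lemma subst_C (L : Matrix (Fin 3) (Fin 3) ℂ) (r : ℂ) : subst L (C r) = C r := by
  simp [subst, algebraMap_eq]

lemma eval_subst (L : Matrix (Fin 3) (Fin 3) ℂ) (u : Fin 3 → ℂ) (f : Ternary) :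
    eval u (subst L f) = eval (L.mulVec u) f := by
  induction f using MvPolynomial.induction_on with
  | C r => simp
  | add p q hp hq => simp [hp, hq]
  | mul_X p i hp => simp [hp, eval_lin, Matrix.mulVec]

lemma subst_subst (L M : Matrix (Fin 3) (Fin 3) ℂ) (f : Ternary) :
    subst L (subst M f) = subst (M * L) f := by
  refine MvPolynomial.funext fun u => ?_
  simp [eval_subst]

lemma subst_one (f : Ternary) : subst 1 f = f := by
  refine MvPolynomial.funext fun u => ?_
  simp [eval_subst]

lemma pderiv_subst (L : Matrix (Fin 3) (Fin 3) ℂ) (i : Fin 3) (f : Ternary) :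
    pderiv i (subst L f) = ∑ j, subst L (pderiv j f) * C (L j i) := by
  induction f using MvPolynomial.induction_on with
  | C r => simp
  | add p q hp hq => simp [hp, hq, add_mul, Finset.sum_add_distrib]
  | mul_X p k hp =>
    have h : pderiv i (lin (L k)) = C (L k i) := by
      simp [lin, pderiv_X, Pi.single_apply]
    simp only [map_mul, subst_X, Derivation.leibniz, h, hp, smul_eq_mul, pderiv_X, map_add,
      add_mul, Finset.sum_add_distrib, Finset.mul_sum]
    congr 1
    · simp [Pi.single_apply]
    · exact Finset.sum_congr rfl fun j _ => by ring

/-- The Hessian determinant is a covariant of weight two. -/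
lemma hess_subst (L : Matrix (Fin 3) (Fin 3) ℂ) (f : Ternary) :
    hess (subst L f) = C (L.det ^ 2) * subst L (hess f) := by
  have key : (Matrix.of fun i j : Fin 3 => pderiv i (pderiv j (subst L f))) =
      (L.map C).transpose *
        (subst L).mapMatrix (Matrix.of fun i j : Fin 3 => pderiv i (pderiv j f)) * L.map C := by
    ext1 i j
    simp only [Matrix.of_apply, pderiv_subst, map_sum, Derivation.leibniz, pderiv_C, smul_eq_mul,
      mul_zero, zero_add, Matrix.mul_apply, Matrix.transpose_apply, Matrix.map_apply,
      AlgHom.mapMatrix_apply, Finset.mul_sum, Finset.sum_mul]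
    exact Finset.sum_congr rfl fun k _ => Finset.sum_congr rfl fun l _ => by ring
  have hC : (L.map C : Matrix (Fin 3) (Fin 3) Ternary).det = C L.det :=
    ((C : ℂ →+* Ternary).map_det L).symm
  rw [hess, key, Matrix.det_mul, Matrix.det_mul, Matrix.det_transpose, hC, hess, AlgHom.map_det,
    C_pow]
  ring

/-- The ternary cubic with coefficients `c`, evaluated at `(x, y, z)`. -/
def cubic {A : Type*} [CommRing A] [Algebra ℂ A] (c : Fin 10 → ℂ) (x y z : A) : A :=
  algebraMap ℂ A (c 0) * y ^ 3 + algebraMap ℂ A (c 1) * (y ^ 2 * z) +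
    algebraMap ℂ A (c 2) * (y * z ^ 2) + algebraMap ℂ A (c 3) * z ^ 3 +
    x * (algebraMap ℂ A (c 4) * y ^ 2 + algebraMap ℂ A (c 5) * (y * z) +
      algebraMap ℂ A (c 6) * z ^ 2) +
    x ^ 2 * (algebraMap ℂ A (c 7) * y + algebraMap ℂ A (c 8) * z) + algebraMap ℂ A (c 9) * x ^ 3

lemma eval_cubic (u : Fin 3 → ℂ) (c : Fin 10 → ℂ) (x y z : Ternary) :
    eval u (cubic c x y z) = cubic c (eval u x) (eval u y) (eval u z) := by
  simp [cubic, algebraMap_eq]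

lemma coeff_eq_zero_of_cubic_eq_zero {c : Fin 10 → ℂ}
    (h : ∀ x y z : ℂ, cubic c x y z = 0) (i : Fin 10) : c i = 0 := by
  simp only [cubic, Algebra.algebraMap_self, RingHom.id_apply] at h
  have h0 := h 0 1 0
  have h3 := h 0 0 1
  have h9 := h 1 0 0
  have a1 := h 0 1 1
  have a2 := h 0 1 (-1)
  have b1 := h 1 1 0
  have b2 := h 1 (-1) 0
  have d1 := h 1 0 1
  have d2 := h 1 0 (-1)
  have e := h 1 1 1
  norm_num at h0 h3 h9 a1 a2 b1 b2 d1 d2 e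
  fin_cases i <;> simp only [Fin.isValue, Fin.reduceFinMk, Fin.zero_eta, Fin.mk_one] <;> grind

lemma exists_eq_cubic {f : Ternary} (hf : f.IsHomogeneous 3) :
    ∃ c, f = cubic c (X 0) (X 1) (X 2) := by
  have h2 := fun i => hf.pderiv (i := i)
  have h1 := fun i j => (h2 i).pderiv (i := j)
  choose r hr using fun i j k => eq_C_of_isHomogeneous_zero ((h1 i j).pderiv (i := k))
  have e3 := hf.sum_X_mul_pderiv
  have e2 := fun i => (h2 i).sum_X_mul_pderiv
  have e1 := fun i j => (h1 i j).sum_X_mul_pderiv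
  simp only [hr, Fin.sum_univ_three, nsmul_eq_mul] at e1 e2 e3
  norm_num at e1 e2 e3
  refine ⟨![r 1 1 1 / 6, (r 1 1 2 + r 1 2 1 + r 2 1 1) / 6, (r 1 2 2 + r 2 1 2 + r 2 2 1) / 6,
    r 2 2 2 / 6, (r 0 1 1 + r 1 0 1 + r 1 1 0) / 6,
    (r 0 1 2 + r 0 2 1 + r 1 0 2 + r 1 2 0 + r 2 0 1 + r 2 1 0) / 6,
    (r 0 2 2 + r 2 0 2 + r 2 2 0) / 6, (r 0 0 1 + r 0 1 0 + r 1 0 0) / 6,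
    (r 0 0 2 + r 0 2 0 + r 2 0 0) / 6, r 0 0 0 / 6], ?_⟩
  refine MvPolynomial.funext fun u => ?_
  have e1' := fun i j => congrArg (eval u) (e1 i j)
  have e2' := fun i => congrArg (eval u) (e2 i)
  have e3' := congrArg (eval u) e3
  simp only [map_add, map_mul, eval_X, eval_C, map_ofNat] at e1' e2' e3'
  simp only [← e1'] at e2'
  rw [eval_cubic]
  simp [cubic]
  linear_combination (-1/3) * e3' + (-1/6) * (u 0 * e2' 0 + u 1 * e2' 1 + u 2 * e2' 2)

/-- The coefficients of the Hessian determinant of the cubic with coefficients `c`. -/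
def hessCoeff (c : Fin 10 → ℂ) : Fin 10 → ℂ :=
  ![24 * c 0 * c 2 * c 7 - 8 * c 1 ^ 2 * c 7 - 8 * c 2 * c 4 ^ 2 + 8 * c 1 * c 4 * c 5 - 6 *
      c 0 * c 5 ^ 2,
    72 * c 0 * c 3 * c 7 - 8 * c 1 * c 2 * c 7 + 24 * c 0 * c 2 * c 8 - 8 * c 1 ^ 2 * c 8 - 24
      * c 3 * c 4 ^ 2 + 16 * c 1 * c 4 * c 6 + 2 * c 1 * c 5 ^ 2 - 24 * c 0 * c 5 * c 6,
    24 * c 1 * c 3 * c 7 - 8 * c 2 ^ 2 * c 7 + 72 * c 0 * c 3 * c 8 - 8 * c 1 * c 2 * c 8 - 24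
      * c 3 * c 4 * c 5 + 16 * c 2 * c 4 * c 6 + 2 * c 2 * c 5 ^ 2 - 24 * c 0 * c 6 ^ 2,
    24 * c 1 * c 3 * c 8 - 8 * c 2 ^ 2 * c 8 - 6 * c 3 * c 5 ^ 2 + 8 * c 2 * c 5 * c 6 - 8 *
      c 1 * c 6 ^ 2,
    24 * c 0 * c 6 * c 7 - 8 * c 2 * c 4 * c 7 + 72 * c 0 * c 2 * c 9 - 24 * c 1 ^ 2 * c 9 - 8
      * c 4 ^ 2 * c 6 + 16 * c 1 * c 4 * c 8 + 2 * c 4 * c 5 ^ 2 - 24 * c 0 * c 5 * c 8,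
    24 * c 1 * c 6 * c 7 - 24 * c 3 * c 4 * c 7 - 8 * c 2 * c 5 * c 7 - 24 * c 0 * c 6 * c 8 +
      24 * c 2 * c 4 * c 8 - 8 * c 1 * c 5 * c 8 + 216 * c 0 * c 3 * c 9 - 24 * c 1 * c 2 *
      c 9 - 8 * c 4 * c 5 * c 6 + 2 * c 5 ^ 3,
    -8 * c 1 * c 6 * c 8 + 24 * c 3 * c 4 * c 8 + 72 * c 1 * c 3 * c 9 - 24 * c 2 ^ 2 * c 9 -
      24 * c 3 * c 5 * c 7 + 16 * c 2 * c 6 * c 7 + 2 * c 5 ^ 2 * c 6 - 8 * c 4 * c 6 ^ 2,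
    -8 * c 4 * c 6 * c 7 + 2 * c 5 ^ 2 * c 7 + 72 * c 0 * c 6 * c 9 + 24 * c 2 * c 4 * c 9 -
      24 * c 1 * c 5 * c 9 - 8 * c 2 * c 7 ^ 2 + 16 * c 1 * c 7 * c 8 - 24 * c 0 * c 8 ^ 2,
    -8 * c 4 * c 6 * c 8 + 2 * c 5 ^ 2 * c 8 + 24 * c 1 * c 6 * c 9 + 72 * c 3 * c 4 * c 9 -
      24 * c 2 * c 5 * c 9 - 24 * c 3 * c 7 ^ 2 + 16 * c 2 * c 7 * c 8 - 8 * c 1 * c 8 ^ 2,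
    24 * c 4 * c 6 * c 9 - 6 * c 5 ^ 2 * c 9 - 8 * c 6 * c 7 ^ 2 + 8 * c 5 * c 7 * c 8 - 8 *
      c 4 * c 8 ^ 2]

lemma hess_cubic (c : Fin 10 → ℂ) :
    hess (cubic c (X 0) (X 1) (X 2)) = cubic (hessCoeff c) (X 0) (X 1) (X 2) := by
  refine MvPolynomial.funext fun u => ?_
  rw [eval_cubic, hess, Matrix.det_fin_three]
  have h2 (i : Fin 3) : pderiv i (2 : Ternary) = 0 := (pderiv i).map_natCast 2
  have h3 (i : Fin 3) : pderiv i (3 : Ternary) = 0 := (pderiv i).map_natCast 3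
  simp [cubic, hessCoeff, algebraMap_eq, pderiv_X, Derivation.leibniz_pow, h2, h3]
  ring

/-- The model cubic: an irreducible conic together with a tangent line. -/
noncomputable def conicTangent : Ternary := X 0 * (X 0 * X 2 + X 1 ^ 2)

lemma conicTangent_eq_cubic :
    conicTangent = cubic ![0, 0, 0, 0, 1, 0, 0, 0, 1, 0] (X 0) (X 1) (X 2) := by
  simp [conicTangent, cubic]
  ring

lemma hess_subst_conicTangent (L : Matrix (Fin 3) (Fin 3) ℂ) :
    hess (subst L conicTangent) = C (-8 * L.det ^ 2) * lin (L 0) ^ 3 := by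
  have h : hess conicTangent = C (-8) * X 0 ^ 3 := by
    rw [conicTangent_eq_cubic, hess_cubic]
    simp [cubic, hessCoeff, algebraMap_eq]
  rw [hess_subst, h, map_mul, subst_C, map_pow (subst L), subst_X, C_mul]
  ring

lemma exists_conicTangent_iff (f : Ternary) :
    (∃ a b c : Ternary, IsLinearForm a ∧ IsLinearForm b ∧ IsLinearForm c ∧
      LinearIndependent ℂ ![a, b, c] ∧ f = a * (a * c + b ^ 2)) ↔
    ∃ L : Matrix (Fin 3) (Fin 3) ℂ, L.det ≠ 0 ∧ f = subst L conicTangent := by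
  constructor
  · rintro ⟨a, b, c, ha, hb, hc, h, rfl⟩
    obtain ⟨u, rfl⟩ := ha.exists_eq_lin
    obtain ⟨v, rfl⟩ := hb.exists_eq_lin
    obtain ⟨w, rfl⟩ := hc.exists_eq_lin
    exact ⟨Matrix.of ![u, v, w], (linearIndependent_lin_iff (Matrix.of ![u, v, w])).1 h,
      by simp only [conicTangent, map_mul, map_add, map_pow, subst_X]; rfl⟩
  · rintro ⟨L, hL, rfl⟩
    exact ⟨lin (L 0), lin (L 1), lin (L 2), isLinearForm_lin _, isLinearForm_lin _,
      isLinearForm_lin _, (linearIndependent_lin_iff L).2 hL, by simp [conicTangent]⟩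

lemma exists_det_ne_zero_of_row {v : Fin 3 → ℂ} (hv : v ≠ 0) :
    ∃ L : Matrix (Fin 3) (Fin 3) ℂ, L.det ≠ 0 ∧ L 0 = v := by
  obtain ⟨i, hi⟩ := Function.ne_iff.1 hv
  fin_cases i
  · exact ⟨Matrix.of ![v, ![0, 1, 0], ![0, 0, 1]], by simpa [Matrix.det_fin_three] using hi, rfl⟩
  · exact ⟨Matrix.of ![v, ![1, 0, 0], ![0, 0, 1]], by simpa [Matrix.det_fin_three] using hi, rfl⟩
  · exact ⟨Matrix.of ![v, ![1, 0, 0], ![0, 1, 0]], by simpa [Matrix.det_fin_three] using hi, rfl⟩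

lemma exists_root_cubic {p : ℂ} (hp : p ≠ 0) (q r s : ℂ) :
    ∃ t, p * t ^ 3 + q * t ^ 2 + r * t + s = 0 := by
  obtain ⟨t, ht⟩ := IsAlgClosed.exists_root
    (Polynomial.C p * Polynomial.X ^ 3 + Polynomial.C q * Polynomial.X ^ 2 +
      Polynomial.C r * Polynomial.X + Polynomial.C s) (by simp [Polynomial.degree_cubic hp])
  exact ⟨t, by simpa using ht⟩

/-- In a suitable frame starting with a given linear form `v`, a cubic vanishes at a chosen
point of the line `v = 0`. -/
lemma exists_subst_cubic {f : Ternary} (hf : f.IsHomogeneous 3) {v : Fin 3 → ℂ} (hv : v ≠ 0) :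
    ∃ (L : Matrix (Fin 3) (Fin 3) ℂ) (c : Fin 10 → ℂ), L.det ≠ 0 ∧ L 0 = v ∧ c 0 = 0 ∧
      f = subst L (cubic c (X 0) (X 1) (X 2)) := by
  obtain ⟨M, hM, rfl⟩ := exists_det_ne_zero_of_row hv
  obtain ⟨c, hc⟩ := exists_eq_cubic (f := subst M⁻¹ f)
    (by simpa only [one_mul, subst] using hf.aeval _ fun i => isLinearForm_lin (M⁻¹ i))
  have hfM : f = subst M (cubic c (X 0) (X 1) (X 2)) := by
    rw [← hc, subst_subst, Matrix.nonsing_inv_mul _ (isUnit_iff_ne_zero.2 hM), subst_one]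
  by_cases h0 : c 0 = 0
  · exact ⟨M, c, hM, rfl, h0, hfM⟩
  obtain ⟨t, ht⟩ := exists_root_cubic h0 (c 1) (c 2) (c 3)
  let N : Matrix (Fin 3) (Fin 3) ℂ := !![1, 0, 0; 0, 0, 1; 0, 1, -t]
  refine ⟨N * M, ![0, 3 * c 0 * t ^ 2 + 2 * c 1 * t + c 2, 3 * c 0 * t + c 1, c 0,
    c 4 * t ^ 2 + c 5 * t + c 6, 2 * c 4 * t + c 5, c 4, c 7 * t + c 8, c 7, c 9],
    ?_, ?_, rfl, ?_⟩
  · rw [Matrix.det_mul]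
    exact mul_ne_zero (by simp [N, Matrix.det_fin_three]) hM
  · ext i
    simp [N, Matrix.mul_apply, Fin.sum_univ_three]
  · rw [hfM, ← subst_subst]
    congr 1
    refine MvPolynomial.funext fun u => ?_
    rw [eval_subst, eval_cubic, eval_cubic]
    simp [N, cubic, dotProduct, Fin.sum_univ_three]
    linear_combination u 2 ^ 3 * ht

lemma coeff_one_eq_zero {c : Fin 10 → ℂ} (h0 : c 0 = 0) (h : ∀ i ≠ 9, hessCoeff c i = 0)
    (h9 : hessCoeff c 9 ≠ 0) : c 1 = 0 := by
  by_contra h1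
  refine h9 ?_
  have e030 := h 0 (by decide)
  have e021 := h 1 (by decide)
  have e003 := h 3 (by decide)
  have e120 := h 4 (by decide)
  simp only [hessCoeff, Matrix.cons_val, h0] at e030 e021 e003 e120 ⊢
  clear h h9 h0
  generalize c 1 = c1, c 2 = c2, c 3 = c3, c 4 = c4, c 5 = c5, c 6 = c6, c 7 = c7, c 8 = c8,
    c 9 = c9 at *
  obtain ⟨s, rfl⟩ : ∃ s, c2 = c1 * s := ⟨c2 / c1, by field_simp⟩
  obtain ⟨t, rfl⟩ : ∃ t, c3 = c1 * t := ⟨c3 / c1, by field_simp⟩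
  obtain ⟨u, rfl⟩ : ∃ u, c4 = c1 * u := ⟨c4 / c1, by field_simp⟩
  obtain ⟨v, rfl⟩ : ∃ v, c5 = c1 * v := ⟨c5 / c1, by field_simp⟩
  obtain ⟨w, rfl⟩ : ∃ w, c6 = c1 * w := ⟨c6 / c1, by field_simp⟩
  obtain rfl : c7 = c1 * (u * v - s * u ^ 2) := by
    apply mul_left_cancel₀ (pow_ne_zero 2 h1)
    linear_combination (-1/8) * e030
  obtain rfl : c8 = c1 * (-s * (u * v - s * u ^ 2) - 3 * t * u ^ 2 + 2 * u * w + v ^ 2 / 4) := by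
    apply mul_left_cancel₀ (pow_ne_zero 2 h1)
    linear_combination (-1/8) * e021
  obtain rfl : w = s * (v / 2 - s * u) + 3 * t * u := by
    rw [← sub_eq_zero, ← pow_eq_zero_iff two_ne_zero]
    apply mul_left_cancel₀ (pow_ne_zero 3 h1)
    linear_combination (-1/8) * e003
  obtain rfl : c9 = c1 * (-8 * s * u * (u * v - s * u ^ 2) -
      8 * u ^ 2 * (s * (v / 2 - s * u) + 3 * t * u) +
      16 * u * (-s * (u * v - s * u ^ 2) - 3 * t * u ^ 2 +
        2 * u * (s * (v / 2 - s * u) + 3 * t * u) + v ^ 2 / 4) + 2 * u * v ^ 2) / 24 := by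
    apply mul_left_cancel₀ (pow_ne_zero 2 h1)
    linear_combination (-1/24) * e120
  ring

lemma coeff_two_three_eq_zero {c : Fin 10 → ℂ} (h0 : c 0 = 0) (h1 : c 1 = 0)
    (h : ∀ i ≠ 9, hessCoeff c i = 0) (h9 : hessCoeff c 9 ≠ 0) : c 2 = 0 ∧ c 3 = 0 := by
  have e030 := h 0 (by decide)
  have e012 := h 2 (by decide)
  have e003 := h 3 (by decide)
  have e111 := h 5 (by decide)
  have e102 := h 6 (by decide)
  have e201 := h 8 (by decide)
  simp only [hessCoeff, Matrix.cons_val, h0, h1] at e030 e012 e003 e111 e102 e201 h9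
  clear h h0 h1
  grind

lemma discriminant_eq_zero {c : Fin 10 → ℂ} (h0 : c 0 = 0) (h1 : c 1 = 0) (h2 : c 2 = 0)
    (h3 : c 3 = 0) (h : ∀ i ≠ 9, hessCoeff c i = 0) : c 5 ^ 2 = 4 * c 4 * c 6 := by
  have e120 := h 4 (by decide)
  have e111 := h 5 (by decide)
  have e102 := h 6 (by decide)
  simp only [hessCoeff, Matrix.cons_val, h0, h1, h2, h3] at e120 e111 e102
  clear h
  grind

lemma exists_sq_of_discriminant {p q r : ℂ} (h : q ^ 2 = 4 * p * r) :
    ∃ s t : ℂ, p = s ^ 2 ∧ q = 2 * s * t ∧ r = t ^ 2 := by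
  obtain ⟨s, rfl⟩ := IsAlgClosed.exists_pow_nat_eq p two_pos
  obtain ⟨t, rfl⟩ := IsAlgClosed.exists_pow_nat_eq r two_pos
  have hq : (q - 2 * s * t) * (q + 2 * s * t) = 0 := by linear_combination h
  rcases mul_eq_zero.1 hq with hq | hq
  · exact ⟨s, t, rfl, sub_eq_zero.1 hq, rfl⟩
  · exact ⟨s, -t, rfl, by linear_combination hq, by ring⟩

lemma hessCoeff_of_hess_eq {L : Matrix (Fin 3) (Fin 3) ℂ} (hL : L.det ≠ 0) {c : Fin 10 → ℂ}
    (h : hess (subst L (cubic c (X 0) (X 1) (X 2))) = lin (L 0) ^ 3) :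
    (∀ i ≠ 9, hessCoeff c i = 0) ∧ hessCoeff c 9 ≠ 0 := by
  rw [hess_subst, hess_cubic] at h
  have key (i : Fin 10) : L.det ^ 2 * hessCoeff c i - (if i = 9 then 1 else 0) = 0 := by
    refine coeff_eq_zero_of_cubic_eq_zero
      (c := fun i => L.det ^ 2 * hessCoeff c i - (if i = 9 then 1 else 0)) (fun x y z => ?_) i
    have hxyz := congrArg (eval (L⁻¹.mulVec ![x, y, z])) h
    have hX : lin (L 0) = subst L (X 0) := (subst_X L 0).symm
    rw [hX, map_mul, map_pow (eval _), eval_C, eval_subst, eval_subst, Matrix.mulVec_mulVec,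
      Matrix.mul_nonsing_inv _ (isUnit_iff_ne_zero.2 hL), Matrix.one_mulVec, eval_cubic] at hxyz
    simp [cubic] at hxyz ⊢
    linear_combination hxyz
  refine ⟨fun i hi => ?_, fun h9 => ?_⟩
  · simpa [hi, hL] using key i
  · simpa [h9] using key 9

lemma exists_conicTangent_of_hess {f : Ternary} (hf : f.IsHomogeneous 3) {a : Ternary}
    (ha : IsLinearForm a) (ha0 : a ≠ 0) (h : hess f = a ^ 3) :
    ∃ L : Matrix (Fin 3) (Fin 3) ℂ, L.det ≠ 0 ∧ f = subst L conicTangent := by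
  obtain ⟨v, rfl⟩ := ha.exists_eq_lin
  obtain ⟨L, c, hL, rfl, h0, rfl⟩ := exists_subst_cubic hf (v := v)
    (by rintro rfl; simp [lin] at ha0)
  obtain ⟨hc, hc9⟩ := hessCoeff_of_hess_eq hL h
  have h1 := coeff_one_eq_zero h0 hc hc9
  obtain ⟨h2, h3⟩ := coeff_two_three_eq_zero h0 h1 hc hc9
  obtain ⟨s, t, h4, h5, h6⟩ := exists_sq_of_discriminant (discriminant_eq_zero h0 h1 h2 h3 hc)
  let K : Matrix (Fin 3) (Fin 3) ℂ := !![1, 0, 0; 0, s, t; c 9, c 7, c 8]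
  have hK : subst L (cubic c (X 0) (X 1) (X 2)) = subst (K * L) conicTangent := by
    rw [← subst_subst]
    congr 1
    refine MvPolynomial.funext fun u => ?_
    rw [eval_subst, eval_cubic]
    simp [K, cubic, conicTangent, dotProduct, Fin.sum_univ_three, h0, h1, h2, h3,
      h4, h5, h6]
    ring
  refine ⟨K * L, fun hdet => ?_, hK⟩
  rw [hK, hess_subst_conicTangent, hdet] at h
  exact pow_ne_zero 3 ha0 (by simpa using h.symm)

lemma exists_hess_eq_of_conicTangent {L : Matrix (Fin 3) (Fin 3) ℂ} (hL : L.det ≠ 0) :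
    ∃ a : Ternary, IsLinearForm a ∧ a ≠ 0 ∧ hess (subst L conicTangent) = a ^ 3 := by
  obtain ⟨r, hr⟩ := IsAlgClosed.exists_pow_nat_eq (-8 * L.det ^ 2) (n := 3) (by norm_num)
  have hr0 : r ≠ 0 := by
    rintro rfl
    simp [hL] at hr
  refine ⟨C r * lin (L 0), (isLinearForm_lin _).C_mul r, mul_ne_zero (by simpa using hr0) ?_, ?_⟩
  · exact ((linearIndependent_lin_iff L).2 hL).ne_zero 0
  · rw [hess_subst_conicTangent, ← hr]
    simp [mul_pow]

lemma exists_sum_five_cubes (L : Matrix (Fin 3) (Fin 3) ℂ) :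
    ∃ l : Fin 5 → Ternary, (∀ i, IsLinearForm (l i)) ∧ subst L conicTangent = ∑ i, l i ^ 3 := by
  obtain ⟨r, hr⟩ := IsAlgClosed.exists_pow_nat_eq (1 / 6 : ℂ) (n := 3) (by norm_num)
  obtain ⟨s, hs⟩ := IsAlgClosed.exists_pow_nat_eq (-1 / 3 : ℂ) (n := 3) (by norm_num)
  let P : Fin 5 → Fin 3 → ℂ := ![![r, r, 0], ![r, -r, 0], ![2 / 3 * r, 0, r],
    ![-4 / 3 * r, 0, r], ![-1 / 3 * s, 0, s]]
  refine ⟨fun i => lin (Matrix.vecMul (P i) L), fun i => isLinearForm_lin _, ?_⟩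
  refine MvPolynomial.funext fun u => ?_
  simp only [map_sum, map_pow, eval_subst, eval_lin, ← Matrix.dotProduct_mulVec]
  generalize L.mulVec u = w
  simp [P, Fin.sum_univ_succ, dotProduct, conicTangent]
  linear_combination (-1) * ((w 0 + w 1) ^ 3 + (w 0 - w 1) ^ 3 + (w 2 + 2 / 3 * w 0) ^ 3 +
    (w 2 - 4 / 3 * w 0) ^ 3) * hr - (w 2 - w 0 / 3) ^ 3 * hs

/-- The scalar form of the lower bound for the Waring rank. -/
lemma not_sum_four_cubes (p : Fin 4 → Fin 3 → ℂ)
    (h : ∀ x y z : ℂ, x * (x * z + y ^ 2) = ∑ i, (p i ⬝ᵥ ![x, y, z]) ^ 3) : False := by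
  set α : Fin 4 → ℂ := fun i => p i 0 with hα
  set β : Fin 4 → ℂ := fun i => p i 1 with hβ
  set γ : Fin 4 → ℂ := fun i => p i 2 with hγ
  have key := coeff_eq_zero_of_cubic_eq_zero (c := ![∑ i, β i ^ 3, 3 * ∑ i, β i ^ 2 * γ i,
    3 * ∑ i, β i * γ i ^ 2, ∑ i, γ i ^ 3, 3 * ∑ i, α i * β i ^ 2 - 1, 6 * ∑ i, α i * β i * γ i,
    3 * ∑ i, α i * γ i ^ 2, 3 * ∑ i, α i ^ 2 * β i, 3 * ∑ i, α i ^ 2 * γ i - 1, ∑ i, α i ^ 3])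
    (fun x y z => by
      have := h x y z
      simp [dotProduct, Fin.sum_univ_succ, cubic, hα, hβ, hγ] at this ⊢
      linear_combination -this)
  have b3 : ∑ i, β i ^ 3 = 0 := by simpa using key 0
  have b2c : ∑ i, β i ^ 2 * γ i = 0 := by simpa using key 1
  have bc2 : ∑ i, β i * γ i ^ 2 = 0 := by simpa using key 2
  have c3 : ∑ i, γ i ^ 3 = 0 := by simpa using key 3
  have ab2 : ∑ i, α i * β i ^ 2 = 1 / 3 := by
    have : 3 * ∑ i, α i * β i ^ 2 - 1 = 0 := by simpa using key 4
    linear_combination this / 3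
  have abc : ∑ i, α i * β i * γ i = 0 := by simpa using key 5
  have ac2 : ∑ i, α i * γ i ^ 2 = 0 := by simpa using key 6
  have a2b : ∑ i, α i ^ 2 * β i = 0 := by simpa using key 7
  have a2c : ∑ i, α i ^ 2 * γ i = 1 / 3 := by
    have : 3 * ∑ i, α i ^ 2 * γ i - 1 = 0 := by simpa using key 8
    linear_combination this / 3
  have a3 : ∑ i, α i ^ 3 = 0 := by simpa using key 9
  clear key h
  clear_value α β γ
  obtain ⟨j, hj⟩ : ∃ j, γ j ≠ 0 := by
    by_contra! hγ0
    simp [hγ0] at a2c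
  let N : Matrix (Fin 4) (Fin 4) ℂ := Matrix.of ![α, β, γ, Pi.single j 1]
  have hNw (w : Fin 4 → ℂ) :
      N.mulVec w = ![∑ i, α i * w i, ∑ i, β i * w i, ∑ i, γ i * w i, w j] := by
    ext i
    fin_cases i <;> simp [N, Matrix.mulVec, dotProduct, Pi.single_apply]
  have hN : N.det ≠ 0 := by
    intro hdet
    obtain ⟨v, hv, hvN⟩ := Matrix.exists_vecMul_eq_zero_iff.2 hdet
    have pair (w : Fin 4 → ℂ) : v 0 * (∑ i, α i * w i) + v 1 * (∑ i, β i * w i) +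
        v 2 * (∑ i, γ i * w i) + v 3 * w j = 0 := by
      have h1 : Matrix.vecMul v N ⬝ᵥ w = 0 := by rw [hvN, zero_dotProduct]
      rw [← Matrix.dotProduct_mulVec, hNw] at h1
      simp only [dotProduct, Fin.sum_univ_four (fun i => v i * _), Matrix.cons_val] at h1
      exact h1
    have p1 := pair fun i => γ i ^ 2
    have p2 := pair fun i => α i ^ 2
    have p3 := pair fun i => α i * β i
    have p4 := pair fun i => α i * γ i
    simp only [Fin.sum_univ_four] at p1 p2 p3 p4 b3 b2c bc2 c3 ab2 abc ac2 a2b a2c a3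
    have v3 : v 3 = 0 := by
      have : v 3 * γ j ^ 2 = 0 := by
        linear_combination p1 - v 0 * ac2 - v 1 * bc2 - v 2 * c3
      simpa [hj] using this
    rw [v3] at p2 p3 p4
    have v0 : v 0 = 0 := by linear_combination 3 * (p4 - v 0 * a2c - v 1 * abc - v 2 * ac2)
    have v1 : v 1 = 0 := by linear_combination 3 * (p3 - v 0 * a2b - v 1 * ab2 - v 2 * abc)
    have v2 : v 2 = 0 := by linear_combination 3 * (p2 - v 0 * a3 - v 1 * a2b - v 2 * a2c)
    exact hv (by ext i; fin_cases i <;> assumption)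
  have vanish (w : Fin 4 → ℂ) (wa : ∑ i, α i * w i = 0) (wb : ∑ i, β i * w i = 0)
      (wc : ∑ i, γ i * w i = 0) (i : Fin 4) : w i * γ j ^ 2 = w j * γ i ^ 2 := by
    have h0 : N.mulVec (fun i => w i * γ j ^ 2 - w j * γ i ^ 2) = 0 := by
      rw [hNw]
      simp only [Fin.sum_univ_four] at wa wb wc bc2 c3 ac2 ⊢
      ext i
      fin_cases i
      · simp
        linear_combination γ j ^ 2 * wa - w j * ac2
      · simp
        linear_combination γ j ^ 2 * wb - w j * bc2
      · simp
        linear_combination γ j ^ 2 * wc - w j * c3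
      · simp
    exact sub_eq_zero.1 (congrFun (Matrix.eq_zero_of_mulVec_eq_zero hN h0) i)
  simp only [Fin.sum_univ_four] at b3 b2c bc2 ab2 abc ac2 a2c vanish
  have hb (i : Fin 4) : β i * γ j = β j * γ i := by
    by_cases hi : γ i = 0
    · have h1 := vanish (fun i => α i * γ i - β i ^ 2) (by linear_combination a2c - ab2)
        (by linear_combination abc - b3) (by linear_combination ac2 - b2c) i
      have h2 : β i = 0 := by simpa [hi, hj] using h1
      simp [hi, h2]
    · have h1 := vanish (fun i => β i * γ i) (by linear_combination abc)
        (by linear_combination b2c) (by linear_combination bc2) i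
      apply mul_left_cancel₀ (mul_ne_zero hi hj)
      linear_combination h1
  have h1 : γ j ^ 2 * (1 / 3) = 0 := by
    have hb2 (i : Fin 4) : β i ^ 2 * γ j ^ 2 = β j ^ 2 * γ i ^ 2 := by
      rw [← mul_pow, hb, mul_pow]
    linear_combination (-γ j ^ 2) * ab2 + β j ^ 2 * ac2 + α 0 * hb2 0 + α 1 * hb2 1 +
      α 2 * hb2 2 + α 3 * hb2 3
  simp [hj] at h1

lemma not_sum_cubes_of_lt_five {L : Matrix (Fin 3) (Fin 3) ℂ} (hL : L.det ≠ 0) {r : ℕ} (hr : r < 5)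
    (l : Fin r → Ternary) (hl : ∀ i, IsLinearForm (l i)) :
    subst L conicTangent ≠ ∑ i, l i ^ 3 := by
  intro h
  choose v hv using fun i => (hl i).exists_eq_lin
  refine not_sum_four_cubes
    (fun i => if hi : i.1 < r then Matrix.vecMul (v ⟨i, hi⟩) L⁻¹ else 0) fun x y z => ?_
  have hxyz := congrArg (eval (L⁻¹.mulVec ![x, y, z])) h
  simp only [hv, map_sum, map_pow, eval_subst, eval_lin, Matrix.mulVec_mulVec,
    Matrix.mul_nonsing_inv _ (isUnit_iff_ne_zero.2 hL), Matrix.one_mulVec,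
    Matrix.dotProduct_mulVec] at hxyz
  simp [conicTangent] at hxyz
  rw [hxyz]
  interval_cases r <;> simp [Fin.sum_univ_succ]

/-- Irreducible conic with tangent line: `Hess f = a³` iff `f = a (a c + b²)`,
in which case `rank f = 5`. -/
theorem conic_tangent_iff (f : Ternary) (hf : MvPolynomial.IsHomogeneous f 3) :
    ((∃ a : Ternary, IsLinearForm a ∧ a ≠ 0 ∧ hess f = a ^ 3) ↔
      (∃ a b c : Ternary, IsLinearForm a ∧ IsLinearForm b ∧ IsLinearForm c ∧
        LinearIndependent ℂ ![a, b, c] ∧ f = a * (a * c + b ^ 2))) ∧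
    ((∃ a b c : Ternary, IsLinearForm a ∧ IsLinearForm b ∧ IsLinearForm c ∧
        LinearIndependent ℂ ![a, b, c] ∧ f = a * (a * c + b ^ 2)) →
      waringRank 3 f = 5) := by
  rw [exists_conicTangent_iff]
  refine ⟨⟨?_, ?_⟩, ?_⟩
  · rintro ⟨a, ha, ha0, h⟩
    exact exists_conicTangent_of_hess hf ha ha0 h
  · rintro ⟨L, hL, rfl⟩
    exact exists_hess_eq_of_conicTangent hL
  · rintro ⟨L, hL, rfl⟩
    refine le_antisymm (Nat.sInf_le (exists_sum_five_cubes L))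
      (le_csInf ⟨5, exists_sum_five_cubes L⟩ ?_)
    rintro r ⟨l, hl, h⟩
    by_contra! hr
    exact not_sum_cubes_of_lt_five hL hr l hl h
end
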